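/- arXiv:1205.3613 — 4 statements merged into one kernel-verified Lean document; each statement's English description precedes it below -/
import Mathlib

section
/- Let M be a finitely generated R-module. If M ⊗_A A/m = 0 for every maximal ideal m of A, then M = 0. -/
open TensorProduct

/-- Nakayama's lemma over all maximal ideals: a finite module `M` with `n • M = M` for every
maximal ideal `n` is trivial. -/
theorem subsingleton_of_forall_isMaximal_smul_top_eq_top {R M : Type*} [CommRing R]
    [AddCommGroup M] [Module R M] [Module.Finite R M]
    (h : ∀ n : Ideal R, n.IsMaximal → n • (⊤ : Submodule R M) = ⊤) : Subsingleton M := by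
  rw [← Module.annihilator_eq_top_iff (R := R)]
  by_contra hne
  obtain ⟨n, hn, hle⟩ := Ideal.exists_le_maximal _ hne
  obtain ⟨r, hr, hrM⟩ := Submodule.exists_sub_one_mem_and_smul_eq_zero_of_fg_of_le_smul n
    (⊤ : Submodule R M) Module.Finite.fg_top (h n hn).ge
  have hrn : r ∈ n := hle (Module.mem_annihilator.mpr fun x => hrM x trivial)
  exact hn.ne_top ((Ideal.eq_top_iff_one n).mpr (by simpa using n.sub_mem hrn hr))

/-- If `M / (n ∩ A)M = 0` for an ideal `n` of an `A`-algebra `R`, then `n • M = M`. -/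
theorem Ideal.smul_top_eq_top_of_subsingleton_quotient_comap_tensor {A R M : Type*}
    [CommRing A] [CommRing R] [Algebra A R] [AddCommGroup M] [Module R M] [Module A M]
    [IsScalarTower A R M] (n : Ideal R)
    [Subsingleton ((A ⧸ n.comap (algebraMap A R)) ⊗[A] M)] :
    n • (⊤ : Submodule R M) = ⊤ := by
  have hp : n.comap (algebraMap A R) • (⊤ : Submodule A M) = ⊤ :=
    Submodule.Quotient.subsingleton_iff.mp
      (quotTensorEquivQuotSMul M (n.comap (algebraMap A R))).symm.toEquiv.subsingleton
  have hle : n.comap (algebraMap A R) • (⊤ : Submodule A M) ≤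
      (n • (⊤ : Submodule R M)).restrictScalars A := by
    refine Submodule.smul_le.mpr fun a ha x _ => ?_
    rw [Submodule.restrictScalars_mem, ← algebraMap_smul R a x]
    exact Submodule.smul_mem_smul (Ideal.mem_comap.mp ha) Submodule.mem_top
  exact eq_top_iff.mpr fun x _ => hle (hp.ge Submodule.mem_top)

/-- A maximal ideal of a finite type algebra over a Jacobson ring contracts to a maximal ideal. -/
theorem Ideal.IsMaximal.comap_algebraMap_of_finiteType {A R : Type*} [CommRing A] [CommRing R]
    [Algebra A R] [IsJacobsonRing A] [Algebra.FiniteType A R] {n : Ideal R} (hn : n.IsMaximal) :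
    (n.comap (algebraMap A R)).IsMaximal := by
  let _ := Ideal.Quotient.field n
  have : Module.Finite A (R ⧸ n) := finite_of_finite_type_of_isJacobsonRing A (R ⧸ n)
  have hbot := Ideal.isMaximal_comap_of_isIntegral_of_isMaximal (R := A) (⊥ : Ideal (R ⧸ n))
  rwa [IsScalarTower.algebraMap_eq A R (R ⧸ n), ← Ideal.comap_comap, ← RingHom.ker_eq_comap_bot,
    Ideal.Quotient.algebraMap_eq, Ideal.mk_ker] at hbot

/-- If `M` is a finitely generated `R`-module (where `R` is a finitely generated algebra
over a finitely generated algebra `A` over a field `k`) such that `M ⊗_A A/m = 0` for every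
maximal ideal `m` of `A`, then `M = 0`. -/
theorem statement0
    (k A R M : Type*) [Field k] [CommRing A] [CommRing R]
    [Algebra k A] [Algebra k R] [Algebra A R] [IsScalarTower k A R]
    [Algebra.FiniteType k A] [Algebra.FiniteType k R]
    [AddCommGroup M] [Module R M] [Module A M] [IsScalarTower A R M]
    [Module.Finite R M]
    (h : ∀ m : Ideal A, m.IsMaximal → Subsingleton ((A ⧸ m) ⊗[A] M)) :
    Subsingleton M := by
  have : IsJacobsonRing A := isJacobsonRing_of_finiteType (A := k)
  have : Algebra.FiniteType A R := .of_restrictScalars_finiteType k A R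
  refine subsingleton_of_forall_isMaximal_smul_top_eq_top (R := R) fun n hn => ?_
  have := h _ hn.comap_algebraMap_of_finiteType
  exact n.smul_top_eq_top_of_subsingleton_quotient_comap_tensor (A := A)
end

section
/- Assume in addition that A is reduced. Let φ : M → N be a homomorphism of finitely generated R-modules such that M is flat as an A-module. If for every maximal ideal m of A the induced map φ ⊗_A A/m : M ⊗_A A/m → N ⊗_A A/m is injective, then φ is injective. -/
open TensorProduct

section Lattice

variable {A K V ι : Type*} [CommRing A] [Field K] [Algebra A K] [AddCommGroup V] [Module K V]
  [Module A V] [IsScalarTower A K V]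

/-- If `K` consists of fractions of elements of `A`, any finite subset of a `K`-vector space has a
common denominator with respect to the `A`-lattice spanned by a finite `K`-basis. -/
theorem exists_forall_smul_mem_span_range [Finite ι]
    (hK : ∀ c : K, ∃ s a : A, algebraMap A K s ≠ 0 ∧ algebraMap A K s * c = algebraMap A K a)
    (b : Module.Basis ι K V) {F : Set V} (hF : F.Finite) :
    ∃ s : A, algebraMap A K s ≠ 0 ∧ ∀ v ∈ F, s • v ∈ Submodule.span A (Set.range b) := by
  classical
  have := Fintype.ofFinite ι
  choose s a hs ha using hK
  refine ⟨∏ v ∈ hF.toFinset, ∏ i, s (b.repr v i), ?_, fun v hv => ?_⟩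
  · simp only [map_prod]
    exact Finset.prod_ne_zero_iff.2 fun v _ => Finset.prod_ne_zero_iff.2 fun i _ => hs _
  · rw [← b.sum_repr v, Finset.smul_sum]
    refine Submodule.sum_mem _ fun i _ => ?_
    obtain ⟨t, ht⟩ : s (b.repr v i) ∣ ∏ v ∈ hF.toFinset, ∏ i, s (b.repr v i) :=
      (Finset.dvd_prod_of_mem (fun i => s (b.repr v i)) (Finset.mem_univ i)).trans
        (Finset.dvd_prod_of_mem (fun v => ∏ i, s (b.repr v i)) (hF.mem_toFinset.2 hv))
    have key : (s (b.repr v i) * t) • b.repr v i • b i = (t * a (b.repr v i)) • b i := by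
      rw [mul_comm, mul_smul, mul_smul, ← algebraMap_smul K (s (b.repr v i)), smul_smul, ha,
        algebraMap_smul]
    rw [ht, key]
    exact Submodule.smul_mem _ _ (Submodule.subset_span ⟨i, rfl⟩)

/-- Elements of `V` that are moved into `L` by a power of `f`. -/
def Submodule.powSaturation (f : A) (L : Submodule A V) : Submodule A V where
  carrier := {v | ∃ n : ℕ, f ^ n • v ∈ L}
  zero_mem' := ⟨0, by simp⟩
  add_mem' := by
    rintro v w ⟨n, hn⟩ ⟨m, hm⟩
    refine ⟨n + m, ?_⟩
    rw [smul_add]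
    refine L.add_mem ?_ ?_
    · rw [pow_add, mul_comm, mul_smul]; exact L.smul_mem _ hn
    · rw [pow_add, mul_smul]; exact L.smul_mem _ hm
  smul_mem' := by
    rintro a v ⟨n, hn⟩
    exact ⟨n, by rw [smul_comm]; exact L.smul_mem _ hn⟩

theorem Submodule.powSaturation_smul_mem {f : A} {L : Submodule A V} {v : V} (n : ℕ)
    (h : f ^ n • v ∈ L.powSaturation f) : v ∈ L.powSaturation f := by
  obtain ⟨m, hm⟩ := h
  exact ⟨m + n, by rwa [pow_add, mul_smul]⟩

end Lattice

section Jacobson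

variable {A R K V M : Type*} [CommRing A] [CommRing R] [Algebra A R] [Field K] [Algebra A K]
  [AddCommGroup V] [Module K V] [Module A V] [IsScalarTower A K V] [Module R V]
  [IsScalarTower A R V] [AddCommGroup M] [Module R M] [Module A M] [IsScalarTower A R M]

/-- If `A` is Jacobson, `L` is the lattice spanned by a `K`-basis and `f ≠ 0` in `K`, then an
element of the lattice with denominators `f` lying in `m L[1/f]` for all maximal `m` vanishes. -/
theorem eq_zero_of_forall_mem_smul_powSaturation [IsJacobsonRing A] {ι : Type*}
    (b : Module.Basis ι K V) {f : A} (hf : algebraMap A K f ≠ 0) {v : V}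
    (hv : v ∈ (Submodule.span A (Set.range b)).powSaturation f)
    (h : ∀ m : Ideal A, m.IsMaximal →
      v ∈ m • (Submodule.span A (Set.range b)).powSaturation f) : v = 0 := by
  set p := RingHom.ker (algebraMap A K) with hp
  have : p.IsPrime := RingHom.ker_isPrime _
  have hpj : p.jacobson = p := IsJacobsonRing.out inferInstance (Ideal.IsPrime.isRadical ‹_›)
  have hcoord : ∀ w ∈ Submodule.span A (Set.range b), ∀ i, ∃ a : A,
      algebraMap A K a = b.repr w i := by
    intro w hw i
    induction hw using Submodule.span_induction with
    | mem w hw =>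
      obtain ⟨j, rfl⟩ := hw
      classical
      exact ⟨if j = i then 1 else 0, by simp [Finsupp.single_apply, apply_ite (algebraMap A K)]⟩
    | zero => exact ⟨0, by simp⟩
    | add w w' _ _ h h' =>
      obtain ⟨a, ha⟩ := h
      obtain ⟨a', ha'⟩ := h'
      exact ⟨a + a', by simp [ha, ha']⟩
    | smul c w _ h =>
      obtain ⟨a, ha⟩ := h
      refine ⟨c * a, ?_⟩
      rw [← algebraMap_smul K c w, map_smul, Finsupp.smul_apply, smul_eq_mul, map_mul, ha]
  obtain ⟨n, hn⟩ := hv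
  refine b.ext_elem fun i => ?_
  obtain ⟨a, ha⟩ := hcoord _ hn i
  rw [← algebraMap_smul K (f ^ n) v, map_smul, Finsupp.smul_apply, smul_eq_mul, map_pow] at ha
  suffices hap : f * a ∈ p by
    rw [hp, RingHom.mem_ker, map_mul, ha] at hap
    simpa [hf] using hap
  rw [← hpj, Ideal.jacobson, Ideal.mem_sInf]
  rintro m ⟨hpm, hm⟩
  by_cases hfm : f ∈ m
  · exact m.mul_mem_right _ hfm
  refine m.mul_mem_left _ ?_
  have hsmul : ∀ w ∈ m • (Submodule.span A (Set.range b)).powSaturation f,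
      ∃ N : ℕ, ∃ c ∈ m, algebraMap A K f ^ N * b.repr w i = algebraMap A K c := by
    intro w hw
    refine Submodule.smul_induction_on hw ?_ ?_
    · rintro c hc w ⟨N, hN⟩
      obtain ⟨d, hd⟩ := hcoord _ hN i
      refine ⟨N, c * d, m.mul_mem_right _ hc, ?_⟩
      rw [← algebraMap_smul K (f ^ N) w] at hd
      rw [← algebraMap_smul K c w, map_mul, hd]
      simp only [map_smul, Finsupp.smul_apply, smul_eq_mul, map_pow]
      ring
    · rintro w w' ⟨N, c, hc, h⟩ ⟨N', c', hc', h'⟩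
      refine ⟨N + N', f ^ N' * c + f ^ N * c',
        m.add_mem (m.mul_mem_left _ hc) (m.mul_mem_left _ hc'), ?_⟩
      simp only [map_add, Finsupp.add_apply, map_mul, map_pow, ← h, ← h']
      ring
  obtain ⟨N, c, hc, hNc⟩ := hsmul v (h m hm)
  have hmem : f ^ N * a - f ^ n * c ∈ m := by
    refine hpm ?_
    rw [hp, RingHom.mem_ker, map_sub, map_mul, map_mul, ha, ← hNc, map_pow, map_pow]
    ring
  have hfa : f ^ N * a ∈ m := by
    simpa using m.add_mem hmem (m.mul_mem_left (f ^ n) hc)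
  exact (hm.isPrime.mem_or_mem hfa).resolve_left fun h' => hfm (hm.isPrime.mem_of_pow_mem _ h')

/-- Let `A` be Jacobson and `M` finite over an `A`-algebra `R` of finite type. A homomorphism from
`M` to a representation of `R` on a finite-dimensional vector space over the field of fractions of
a quotient of `A` kills every element lying in `m M` for all maximal ideals `m` of `A`. -/
theorem LinearMap.apply_eq_zero_of_forall_mem_smul_top [IsJacobsonRing A] [Algebra.FiniteType A R]
    [Module.Finite R M] [Module.Finite K V] [SMulCommClass R K V]
    (hK : ∀ c : K, ∃ s a : A, algebraMap A K s ≠ 0 ∧ algebraMap A K s * c = algebraMap A K a)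
    (g : M →ₗ[R] V) {x : M}
    (hx : ∀ m : Ideal A, m.IsMaximal → x ∈ m • (⊤ : Submodule A M)) : g x = 0 := by
  let b := Module.finBasis K V
  set L := Submodule.span A (Set.range b) with hL
  obtain ⟨T, hT⟩ := Algebra.FiniteType.out (R := A) (A := R)
  obtain ⟨G, hG⟩ := Module.Finite.fg_top (R := R) (M := M)
  obtain ⟨f, hf, hfL⟩ := exists_forall_smul_mem_span_range hK b
    (F := Set.image2 (fun r i => r • b i) (T : Set R) Set.univ ∪ g '' (G : Set M))
    ((T.finite_toSet.image2 _ Set.finite_univ).union (G.finite_toSet.image g))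
  have hsat : ∀ r : R, ∀ v ∈ L.powSaturation f, r • v ∈ L.powSaturation f := by
    intro r
    have hr : r ∈ Algebra.adjoin A (T : Set R) := hT ▸ Algebra.mem_top
    induction hr using Algebra.adjoin_induction with
    | mem r hr =>
      rintro v ⟨n, hn⟩
      refine Submodule.powSaturation_smul_mem n ?_
      rw [smul_comm]
      generalize f ^ n • v = u at hn
      induction hn using Submodule.span_induction with
      | mem w hw =>
        obtain ⟨i, rfl⟩ := hw
        exact ⟨1, by
          rw [pow_one]; exact hfL _ (Or.inl ⟨r, hr, i, Set.mem_univ _, rfl⟩)⟩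
      | zero => simp
      | add w w' _ _ h h' => rw [smul_add]; exact Submodule.add_mem _ h h'
      | smul c w _ h => rw [smul_comm]; exact Submodule.smul_mem _ _ h
    | algebraMap a => intro v hv; rw [algebraMap_smul]; exact Submodule.smul_mem _ _ hv
    | add r r' _ _ h h' =>
      intro v hv; rw [add_smul]; exact Submodule.add_mem _ (h v hv) (h' v hv)
    | mul r r' _ _ h h' => intro v hv; rw [mul_smul]; exact h _ (h' v hv)
  have hg : ∀ y : M, g y ∈ L.powSaturation f := by
    intro y
    have hy : y ∈ Submodule.span R (G : Set M) := hG ▸ Submodule.mem_top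
    induction hy using Submodule.span_induction with
    | mem y hy => exact ⟨1, by rw [pow_one]; exact hfL _ (Or.inr ⟨y, hy, rfl⟩)⟩
    | zero => simp
    | add y y' _ _ h h' => rw [map_add]; exact Submodule.add_mem _ h h'
    | smul r y _ h => rw [map_smul]; exact hsat r _ h
  refine eq_zero_of_forall_mem_smul_powSaturation b hf (hg x) fun m hm => ?_
  refine Submodule.smul_induction_on (hx m hm) ?_ ?_
  · intro a ha y _
    rw [show g (a • y) = a • g y from (g.restrictScalars A).map_smul a y]
    exact Submodule.smul_mem_smul ha (hg y)
  · intro y y' h h'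
    rw [map_add]; exact Submodule.add_mem _ h h'

end Jacobson

/-- In a finite module over a Noetherian ring, a nonzero element is nonzero modulo some power of
some maximal ideal. -/
theorem exists_isMaximal_notMem_pow_smul_top {S W : Type*} [CommRing S] [IsNoetherianRing S]
    [AddCommGroup W] [Module S W] [Module.Finite S W] {w : W} (hw : w ≠ 0) :
    ∃ n : Ideal S, n.IsMaximal ∧ ∃ k : ℕ, w ∉ n ^ k • (⊤ : Submodule S W) := by
  obtain ⟨n, hn, hle⟩ := Ideal.exists_le_maximal (LinearMap.ker (LinearMap.toSpanSingleton S W w))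
    ((Ideal.ne_top_iff_one _).2 (by simpa using hw))
  refine ⟨n, hn, ?_⟩
  by_contra! hcon
  obtain ⟨r, hr⟩ := (n.mem_iInf_smul_pow_eq_bot_iff w).1 (by simpa using hcon)
  refine hn.ne_top ((Ideal.eq_top_iff_one _).2 ?_)
  have : (1 - r : S) ∈ n := hle (by simp [sub_smul, hr])
  simpa using n.add_mem this r.2

/-- The quotient of an algebra of finite type over a field by a power of a maximal ideal is
finite-dimensional. -/
theorem Module.finite_quotient_pow_of_isMaximal (K : Type*) {S : Type*} [Field K] [CommRing S]
    [Algebra K S] [Algebra.FiniteType K S] (n : Ideal S) [n.IsMaximal] (k : ℕ) :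
    Module.Finite K (S ⧸ n ^ k) := by
  rw [Module.finite_iff_krullDimLE_zero]
  refine Ring.KrullDimLE.mk₀ fun P hP => ?_
  have hle : n ^ k ≤ P.comap (Ideal.Quotient.mk (n ^ k)) := by
    intro s hs
    rw [Ideal.mem_comap, Ideal.Quotient.eq_zero_iff_mem.2 hs]
    exact P.zero_mem
  have heq := ‹n.IsMaximal›.eq_of_le (Ideal.IsPrime.ne_top inferInstance)
    (Ideal.IsPrime.le_of_pow_le hle)
  have : (P.comap (Ideal.Quotient.mk (n ^ k))).IsMaximal := heq ▸ ‹_›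
  rw [← Ideal.map_comap_of_surjective _ Ideal.Quotient.mk_surjective P]
  exact this.map_of_surjective_of_ker_le Ideal.Quotient.mk_surjective
    (by rwa [Ideal.mk_ker])

theorem Ideal.ResidueField.exists_mul_eq_algebraMap {A : Type*} [CommRing A] (p : Ideal A)
    [p.IsPrime] (c : p.ResidueField) : ∃ s a : A, algebraMap A p.ResidueField s ≠ 0 ∧
      algebraMap A p.ResidueField s * c = algebraMap A p.ResidueField a := by
  obtain ⟨a, s, hs, rfl⟩ := IsFractionRing.div_surjective (A := A ⧸ p) c
  obtain ⟨a, rfl⟩ := Ideal.Quotient.mk_surjective a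
  obtain ⟨s, rfl⟩ := Ideal.Quotient.mk_surjective s
  have hs0 : algebraMap A p.ResidueField s ≠ 0 := by
    rw [Ne, Ideal.algebraMap_residueField_eq_zero, ← Ideal.Quotient.eq_zero_iff_mem]
    exact nonZeroDivisors.ne_zero hs
  refine ⟨s, a, hs0, ?_⟩
  simp only [Ideal.algebraMap_quotient_residueField_mk]
  field_simp

/-- An element of a flat module over a reduced Noetherian ring which vanishes in all fibers over
prime ideals is zero. -/
theorem Module.Flat.eq_zero_of_forall_tmul_residueField {A M : Type*} [CommRing A] [IsReduced A]
    [IsNoetherianRing A] [AddCommGroup M] [Module A M] [Module.Flat A M] {x : M}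
    (h : ∀ (p : Ideal A) [p.IsPrime], x ⊗ₜ[A] (1 : p.ResidueField) = 0) : x = 0 := by
  classical
  have := (minimalPrimes.finite_of_isNoetherianRing A).fintype
  have hprime (p : minimalPrimes A) : p.1.IsPrime := p.2.1.1
  let ψ : A →ₗ[A] ∀ p : minimalPrimes A, p.1.ResidueField :=
    LinearMap.pi fun p => Algebra.linearMap A _
  have hψ : Function.Injective ψ := by
    rw [injective_iff_map_eq_zero]
    intro a ha
    have : a ∈ sInf (⊥ : Ideal A).minimalPrimes := by
      rw [Ideal.mem_sInf]
      intro p hp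
      have := hp.1.1
      have := congr_fun ha ⟨p, hp⟩
      exact Ideal.algebraMap_residueField_eq_zero.1 this
    rw [Ideal.sInf_minimalPrimes] at this
    exact IsReduced.eq_zero a this
  have hinj := Module.Flat.lTensor_preserves_injective_linearMap (M := M) ψ hψ
  have h0 : x ⊗ₜ[A] (1 : A) = 0 := by
    refine hinj ?_
    apply (TensorProduct.piRight A A M fun p : minimalPrimes A => p.1.ResidueField).injective
    ext p
    simpa [ψ] using h p.1
  simpa using congr_arg (TensorProduct.rid A M) h0

/-- Let `A` be a reduced Noetherian Jacobson ring and `M` a finite module over an `A`-algebra of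
finite type. If `M` is flat over `A`, the intersection of all `m M`, with `m` maximal in `A`, is
zero. -/
theorem Module.Flat.eq_zero_of_forall_mem_smul_top {A R M : Type*} [CommRing A] [CommRing R]
    [Algebra A R] [IsReduced A] [IsNoetherianRing A] [IsJacobsonRing A] [Algebra.FiniteType A R]
    [AddCommGroup M] [Module R M] [Module A M] [IsScalarTower A R M] [Module.Finite R M]
    [Module.Flat A M] {x : M}
    (hx : ∀ m : Ideal A, m.IsMaximal → x ∈ m • (⊤ : Submodule A M)) : x = 0 := by
  refine Module.Flat.eq_zero_of_forall_tmul_residueField (A := A) fun p _ => ?_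
  let K := p.ResidueField
  let S := R ⊗[A] K
  let : Algebra K S := Algebra.TensorProduct.rightAlgebra
  have : IsScalarTower A K S := Algebra.TensorProduct.right_isScalarTower
  have : Algebra.FiniteType K S := .equiv (Algebra.FiniteType.baseChange K)
    (show K ⊗[A] R ≃ₐ[K] S from
      { Algebra.TensorProduct.comm A K R with commutes' := fun c => rfl })
  have : IsNoetherianRing S := Algebra.FiniteType.isNoetherianRing K S
  suffices hW : (1 : S) ⊗ₜ[R] x = 0 by
    have := congr_arg (AlgebraTensorModule.cancelBaseChange A R R M K)
      (congr_arg (TensorProduct.comm R S M) hW)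
    simpa [S, Algebra.TensorProduct.one_def] using this
  by_contra hne
  have : Module.Finite S (S ⊗[R] M) := inferInstance
  obtain ⟨n, hn, k, hk⟩ := exists_isMaximal_notMem_pow_smul_top (S := S) (W := S ⊗[R] M) hne
  have : Module.Finite K (S ⧸ n ^ k) := Module.finite_quotient_pow_of_isMaximal K n k
  let V := (S ⧸ n ^ k) ⊗[S] (S ⊗[R] M)
  have : Module.Finite K V := Module.Finite.trans (S ⧸ n ^ k) V
  let g : M →ₗ[R] V :=
    ((TensorProduct.mk S (S ⧸ n ^ k) (S ⊗[R] M) 1).restrictScalars R).comp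
      (TensorProduct.mk R S M 1)
  have hg : g x = 0 := LinearMap.apply_eq_zero_of_forall_mem_smul_top (K := K)
    (Ideal.ResidueField.exists_mul_eq_algebraMap p) g hx
  refine hk ?_
  have h0 := congr_arg (TensorProduct.quotTensorEquivQuotSMul (S ⊗[R] M) (n ^ k)) hg
  rw [map_zero] at h0
  simp only [g, LinearMap.comp_apply, LinearMap.restrictScalars_apply, TensorProduct.mk_apply] at h0
  rw [← map_one (Ideal.Quotient.mk (n ^ k)),
    TensorProduct.quotTensorEquivQuotSMul_mk_tmul, one_smul] at h0
  exact (Submodule.Quotient.mk_eq_zero _).1 h0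



/-- If `A` is in addition reduced, and `φ : M → N` is a homomorphism of finitely generated
`R`-modules with `M` flat over `A`, such that `φ ⊗_A A/m` is injective for every maximal
ideal `m` of `A`, then `φ` is injective. -/
theorem statement2
    (k A R M N : Type*) [Field k] [CommRing A] [CommRing R]
    [Algebra k A] [Algebra k R] [Algebra A R] [IsScalarTower k A R]
    [Algebra.FiniteType k A] [Algebra.FiniteType k R]
    [IsReduced A]
    [AddCommGroup M] [Module R M] [Module A M] [IsScalarTower A R M]
    [AddCommGroup N] [Module R N] [Module A N] [IsScalarTower A R N]
    [Module.Finite R M] [Module.Finite R N]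
    [Module.Flat A M]
    (φ : M →ₗ[R] N)
    (h : ∀ m : Ideal A, m.IsMaximal →
      Function.Injective (LinearMap.baseChange (A ⧸ m) (LinearMap.restrictScalars A φ))) :
    Function.Injective φ := by
  have hA : IsNoetherianRing A := Algebra.FiniteType.isNoetherianRing k A
  have hJ : IsJacobsonRing A := isJacobsonRing_of_finiteType (A := k)
  have hR : Algebra.FiniteType A R := .of_restrictScalars_finiteType k A R
  refine (injective_iff_map_eq_zero φ).2 fun x hx =>
    Module.Flat.eq_zero_of_forall_mem_smul_top (A := A) (R := R) fun m hm => ?_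
  have h0 : (1 : A ⧸ m) ⊗ₜ[A] x = 0 := h m hm (by simp [hx])
  have := congr_arg (TensorProduct.quotTensorEquivQuotSMul M m) h0
  rw [map_zero, ← map_one (Ideal.Quotient.mk m),
    TensorProduct.quotTensorEquivQuotSMul_mk_tmul, one_smul] at this
  exact (Submodule.Quotient.mk_eq_zero _).1 this
end

section
/- Assume in addition that R is flat as an A-module. Let F₁ →(a) F₂ →(b) F₃ be a complex of finite free R-modules (so b ∘ a = 0) with a injective and b surjective, and let H = ker b / im a be its homology. Then H is flat as an A-module if and only if for every maximal ideal m of A the induced map a ⊗_A A/m : F₁ ⊗_A A/m → F₂ ⊗_A A/m is injective. -/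
open TensorProduct

section TensorInjective

variable {A F G H N N' N'' : Type*} [CommRing A]
  [AddCommGroup F] [Module A F] [AddCommGroup G] [Module A G] [AddCommGroup H] [Module A H]
  [AddCommGroup N] [Module A N] [AddCommGroup N'] [Module A N'] [AddCommGroup N''] [Module A N'']

/-- If `0 → N' → N → N'' → 0` and `F → G → H → 0` are exact, `G` is flat and `N'' ⊗ F → N'' ⊗ G`
is injective, then `N' ⊗ H → N ⊗ H` is injective. -/
lemma LinearMap.rTensor_injective_of_lTensor_injective_of_flat [Module.Flat A G]
    {f : F →ₗ[A] G} {g : G →ₗ[A] H} {i : N' →ₗ[A] N} {p : N →ₗ[A] N''}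
    (hfg : Function.Exact f g) (hg : Function.Surjective g)
    (hi : Function.Injective i) (hip : Function.Exact i p) (hp : Function.Surjective p)
    (hf : Function.Injective (f.lTensor N'')) : Function.Injective (i.rTensor H) := by
  rw [injective_iff_map_eq_zero]
  intro y hy
  obtain ⟨z, rfl⟩ := LinearMap.lTensor_surjective N' hg y
  have hz : g.lTensor N (i.rTensor G z) = 0 := by
    rw [← hy, ← LinearMap.comp_apply, ← LinearMap.comp_apply, LinearMap.lTensor_comp_rTensor,
      LinearMap.rTensor_comp_lTensor]
  obtain ⟨u, hu⟩ := (lTensor_exact N hfg hg _).mp hz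
  have hpu : p.rTensor F u = 0 := by
    apply hf
    rw [map_zero, ← LinearMap.comp_apply, LinearMap.lTensor_comp_rTensor,
      ← LinearMap.rTensor_comp_lTensor, LinearMap.comp_apply, hu]
    exact (rTensor_exact G hip hp _).mpr ⟨z, rfl⟩
  obtain ⟨v, rfl⟩ := (rTensor_exact F hip hp _).mp hpu
  have hv : f.lTensor N' v = z := by
    apply Module.Flat.rTensor_preserves_injective_linearMap (M := G) i hi
    rw [← hu, ← LinearMap.comp_apply, ← LinearMap.comp_apply, LinearMap.lTensor_comp_rTensor,
      LinearMap.rTensor_comp_lTensor]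
  rw [← hv]
  exact (lTensor_exact N' hfg hg _).mpr ⟨v, rfl⟩

/-- If `0 → N' → N → N'' → 0` is exact and `G` is flat, then injectivity of `N ⊗ F → N ⊗ G`
follows from injectivity of `N' ⊗ F → N' ⊗ G` and of `N'' ⊗ F → N'' ⊗ G`. -/
lemma LinearMap.lTensor_injective_of_exact [Module.Flat A G]
    {f : F →ₗ[A] G} {i : N' →ₗ[A] N} {p : N →ₗ[A] N''}
    (hi : Function.Injective i) (hip : Function.Exact i p) (hp : Function.Surjective p)
    (hf' : Function.Injective (f.lTensor N')) (hf'' : Function.Injective (f.lTensor N'')) :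
    Function.Injective (f.lTensor N) := by
  rw [injective_iff_map_eq_zero]
  intro x hx
  have hpx : p.rTensor F x = 0 := by
    apply hf''
    rw [map_zero, ← LinearMap.comp_apply, LinearMap.lTensor_comp_rTensor,
      ← LinearMap.rTensor_comp_lTensor, LinearMap.comp_apply, hx, map_zero]
  obtain ⟨v, rfl⟩ := (rTensor_exact F hip hp _).mp hpx
  have hv : f.lTensor N' v = 0 := by
    apply Module.Flat.rTensor_preserves_injective_linearMap (M := G) i hi
    rw [map_zero, ← hx, ← LinearMap.comp_apply, ← LinearMap.comp_apply,
      LinearMap.lTensor_comp_rTensor, LinearMap.rTensor_comp_lTensor]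
  rw [(injective_iff_map_eq_zero _).mp hf' v hv, map_zero]

/-- An injection with flat cokernel stays injective after any base change. -/
lemma LinearMap.lTensor_injective_of_flat_of_exact [Module.Flat A H]
    {f : F →ₗ[A] G} {g : G →ₗ[A] H} (hf : Function.Injective f)
    (hfg : Function.Exact f g) (hg : Function.Surjective g) (N : Type*) [AddCommGroup N]
    [Module A N] : Function.Injective (f.lTensor N) := by
  rw [LinearMap.lTensor_inj_iff_rTensor_inj]
  let φ : (N →₀ A) →ₗ[A] N := Finsupp.linearCombination A _root_.id
  have hφ : Function.Surjective φ := Finsupp.linearCombination_id_surjective A N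
  exact LinearMap.rTensor_injective_of_lTensor_injective_of_flat (F := LinearMap.ker φ)
    φ.exact_subtype_ker_map hφ hf hfg hg
    (Module.Flat.lTensor_preserves_injective_linearMap _ (Submodule.subtype_injective _))

/-- If `F → G → H → 0` is exact with `G` flat and `A/I ⊗ F → A/I ⊗ G` is injective for every
ideal `I`, then `H` is flat. -/
lemma Module.Flat.of_exact_of_lTensor_quotient_injective [Module.Flat A G]
    {f : F →ₗ[A] G} {g : G →ₗ[A] H} (hfg : Function.Exact f g) (hg : Function.Surjective g)
    (hf : ∀ I : Ideal A, Function.Injective (f.lTensor (A ⧸ I))) : Module.Flat A H := by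
  rw [Module.Flat.iff_rTensor_injective']
  exact fun I ↦ LinearMap.rTensor_injective_of_lTensor_injective_of_flat hfg hg
    (Submodule.subtype_injective I) (LinearMap.exact_subtype_mkQ I) (Submodule.mkQ_surjective I)
    (hf I)

/-- Injectivity of `A/m ⊗ F → A/m ⊗ G` for `m` maximal implies injectivity of `N ⊗ F → N ⊗ G` for
every `A/m`-vector space `N`. -/
lemma LinearMap.lTensor_injective_of_isMaximal {m : Ideal A} [m.IsMaximal]
    [Module (A ⧸ m) N] [IsScalarTower A (A ⧸ m) N] {f : F →ₗ[A] G}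
    (hf : Function.Injective (f.lTensor (A ⧸ m))) : Function.Injective (f.lTensor N) := by
  let _ := Ideal.Quotient.field m
  have h := Module.Flat.lTensor_preserves_injective_linearMap (M := N) (f.baseChange (A ⧸ m)) hf
  let eF := AlgebraTensorModule.cancelBaseChange A (A ⧸ m) (A ⧸ m) N F
  let eG := AlgebraTensorModule.cancelBaseChange A (A ⧸ m) (A ⧸ m) N G
  have hcomm : ∀ x, f.lTensor N x = eG ((f.baseChange (A ⧸ m)).lTensor N (eF.symm x)) := by
    intro x
    induction x with
    | zero => simp
    | tmul n x => simp [eF, eG]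
    | add x y hx hy => simp only [map_add, hx, hy]
  intro x y hxy
  rw [hcomm, hcomm] at hxy
  exact eF.symm.injective (h (eG.injective hxy))

end TensorInjective

/-- Injectivity of `A/m ⊗ F → A/m ⊗ G` for `m` maximal and `G` flat implies injectivity of
`N ⊗ F → N ⊗ G` for every module `N` killed by a power of `m`. -/
lemma LinearMap.lTensor_injective_of_pow_le_annihilator {A : Type*} {F G : Type*} [CommRing A]
    [AddCommGroup F] [Module A F] [AddCommGroup G] [Module A G] [Module.Flat A G]
    {m : Ideal A} [m.IsMaximal] {f : F →ₗ[A] G} (hf : Function.Injective (f.lTensor (A ⧸ m)))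
    (j : ℕ) (N : Type*) [AddCommGroup N] [Module A N] (hN : m ^ j ≤ Module.annihilator A N) :
    Function.Injective (f.lTensor N) := by
  induction j generalizing N with
  | zero =>
    have : Subsingleton N := by
      rw [← Module.annihilator_eq_top_iff (R := A), eq_top_iff]
      simpa using hN
    exact Function.injective_of_subsingleton _
  | succ j ih =>
    let P : Submodule A N := m • ⊤
    refine LinearMap.lTensor_injective_of_exact (Submodule.subtype_injective P)
      (LinearMap.exact_subtype_mkQ P) (Submodule.mkQ_surjective P) (ih P ?_)
      (LinearMap.lTensor_injective_of_isMaximal hf)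
    intro r hr
    rw [Module.mem_annihilator]
    rintro ⟨x, hx⟩
    ext
    change r • x = 0
    induction hx using Submodule.smul_induction_on' with
    | smul s hs n _ =>
      rw [← mul_smul]
      exact Module.mem_annihilator.mp (hN (pow_succ m j ▸ Ideal.mul_mem_mul hr hs)) n
    | add x _ y _ hx hy => rw [smul_add, hx, hy, add_zero]

lemma TensorProduct.one_tmul_quotient_eq_zero_iff {A M : Type*} [CommRing A] [AddCommGroup M]
    [Module A M] (I : Ideal A) (x : M) :
    (1 : A ⧸ I) ⊗ₜ[A] x = 0 ↔ x ∈ (I • ⊤ : Submodule A M) := by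
  rw [← (quotTensorEquivQuotSMul M I).map_eq_zero_iff, quotTensorEquivQuotSMul_mk_one_tmul,
    Submodule.Quotient.mk_eq_zero]

/-- `A/I ⊗ F → A/I ⊗ G` is injective if and only if the preimage of `I G` is contained in `I F`. -/
lemma LinearMap.lTensor_quotient_injective_iff {A F G : Type*} [CommRing A]
    [AddCommGroup F] [Module A F] [AddCommGroup G] [Module A G] (f : F →ₗ[A] G) (I : Ideal A) :
    Function.Injective (f.lTensor (A ⧸ I)) ↔
      ∀ x, f x ∈ (I • ⊤ : Submodule A G) → x ∈ (I • ⊤ : Submodule A F) := by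
  rw [injective_iff_map_eq_zero,
    (TensorProduct.mk_surjective A F (A ⧸ I) Ideal.Quotient.mk_surjective).forall]
  simp only [TensorProduct.mk_apply, LinearMap.lTensor_tmul,
    TensorProduct.one_tmul_quotient_eq_zero_iff]

/-- The contraction of a maximal ideal along a map of algebras of finite type over a field is
maximal. -/
lemma Ideal.isMaximal_comap_algebraMap_of_finiteType (k : Type*) {A R : Type*} [Field k]
    [CommRing A] [CommRing R] [Algebra k A] [Algebra k R] [Algebra A R] [IsScalarTower k A R]
    [Algebra.FiniteType k A] [Algebra.FiniteType k R] (q : Ideal R) [q.IsMaximal] :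
    (q.comap (algebraMap A R)).IsMaximal := by
  let _ := Ideal.Quotient.field q
  have : IsJacobsonRing A := isJacobsonRing_of_finiteType (A := k)
  have : Algebra.FiniteType A R := .of_restrictScalars_finiteType k A R
  have : Module.Finite A (R ⧸ q) := finite_of_finite_type_of_isJacobsonRing A (R ⧸ q)
  have h := Ideal.isMaximal_comap_of_isIntegral_of_isMaximal (R := A) (⊥ : Ideal (R ⧸ q))
  rwa [IsScalarTower.algebraMap_eq A R (R ⧸ q), ← Ideal.comap_comap,
    Ideal.Quotient.algebraMap_eq, ← RingHom.ker_eq_comap_bot, Ideal.mk_ker] at h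

/-- Let `M` be a finite module over a noetherian `A`-algebra `R`. An element of `M` lying in
`⋂ j, (q ∩ A) ^ j M` for every maximal ideal `q` of `R` vanishes. -/
lemma eq_zero_of_forall_mem_comap_pow_smul_top {A R M : Type*} [CommRing A] [CommRing R]
    [Algebra A R] [IsNoetherianRing R] [AddCommGroup M] [Module R M] [Module.Finite R M]
    [Module A M] [IsScalarTower A R M] (x : M)
    (hx : ∀ q : Ideal R, q.IsMaximal → ∀ j : ℕ,
      x ∈ ((q.comap (algebraMap A R)) ^ j • ⊤ : Submodule A M)) : x = 0 := by
  by_contra h0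
  obtain ⟨q, hq, hle⟩ := Ideal.exists_le_maximal (Ideal.torsionOf R M x) (by
    rwa [Ne, Ideal.torsionOf_eq_top_iff])
  obtain ⟨⟨r, hr⟩, hrx⟩ := ((q.comap (algebraMap A R)).map
    (algebraMap A R)).mem_iInf_smul_pow_eq_bot_iff x |>.mp (by
      rw [Submodule.mem_iInf]
      intro j
      have hxj := hx q hq j
      rwa [← Submodule.restrictScalars_top A R M, ← Ideal.smul_restrictScalars,
        Ideal.map_pow] at hxj)
  have hr' : r ∈ q := Ideal.map_comap_le hr
  have h1 : 1 - r ∈ q := hle (by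
    simpa [Ideal.mem_torsionOf_iff, sub_smul, sub_eq_zero] using hrx.symm)
  exact hq.ne_top ((Ideal.eq_top_iff_one q).mpr (by simpa using q.add_mem h1 hr'))

/-- Let `R` be a noetherian `A`-algebra whose maximal ideals contract to maximal ideals of `A`, and
let `f : F → G` be `A`-linear, with `F` a finite `R`-module and `G` flat over `A`. If
`A/m ⊗ F → A/m ⊗ G` is injective for every maximal ideal `m`, then so is `A/I ⊗ F → A/I ⊗ G` for
every ideal `I`. -/
lemma LinearMap.lTensor_quotient_injective_of_forall_isMaximal {A R F G : Type*} [CommRing A]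
    [CommRing R] [Algebra A R] [IsNoetherianRing R] [AddCommGroup F] [Module R F]
    [Module.Finite R F] [Module A F] [IsScalarTower A R F] [AddCommGroup G] [Module A G]
    [Module.Flat A G] {f : F →ₗ[A] G}
    (hR : ∀ q : Ideal R, q.IsMaximal → (q.comap (algebraMap A R)).IsMaximal)
    (hf : ∀ m : Ideal A, m.IsMaximal → Function.Injective (f.lTensor (A ⧸ m))) (I : Ideal A) :
    Function.Injective (f.lTensor (A ⧸ I)) := by
  rw [LinearMap.lTensor_quotient_injective_iff]
  intro x hx
  let P : Submodule R F := I.map (algebraMap A R) • ⊤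
  have hP : P.restrictScalars A = I • ⊤ := by
    simp only [P, Ideal.smul_restrictScalars, Submodule.restrictScalars_top]
  rw [← hP, Submodule.restrictScalars_mem, ← Submodule.Quotient.mk_eq_zero]
  refine eq_zero_of_forall_mem_comap_pow_smul_top (A := A) (R := R) _ fun q hq j ↦ ?_
  set m := q.comap (algebraMap A R)
  have : m.IsMaximal := hR q hq
  have hinj : Function.Injective (f.lTensor (A ⧸ (I ⊔ m ^ j))) :=
    LinearMap.lTensor_injective_of_pow_le_annihilator (hf m this) j _
      (by rw [Ideal.annihilator_quotient]; exact le_sup_right)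
  have hxj := (LinearMap.lTensor_quotient_injective_iff f _).mp hinj x
    (Submodule.smul_mono_left le_sup_left hx)
  rw [Submodule.sup_smul, ← hP] at hxj
  obtain ⟨y, hy, z, hz, rfl⟩ := Submodule.mem_sup.mp hxj
  rw [Submodule.Quotient.mk_add, (Submodule.Quotient.mk_eq_zero P).mpr hy, zero_add]
  have := Submodule.mem_map_of_mem (f := P.mkQ.restrictScalars A) hz
  rw [Submodule.map_smul''] at this
  exact Submodule.smul_mono le_rfl le_top this

/-- Suppose moreover that `R` is flat as an `A`-module. Let `F₁ →(a) F₂ →(b) F₃` be a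
complex of finite free `R`-modules with `a` injective and `b` surjective, and let
`H = ker b / im a` be its homology. Then `H` is flat over `A` if and only if
`a ⊗_A A/m` is injective for every maximal ideal `m` of `A`. -/
theorem statement4
    (k A R F₁ F₂ F₃ : Type*) [Field k] [CommRing A] [CommRing R]
    [Algebra k A] [Algebra k R] [Algebra A R] [IsScalarTower k A R]
    [Algebra.FiniteType k A] [Algebra.FiniteType k R]
    [Module.Flat A R]
    [AddCommGroup F₁] [Module R F₁] [Module A F₁] [IsScalarTower A R F₁]
    [AddCommGroup F₂] [Module R F₂] [Module A F₂] [IsScalarTower A R F₂]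
    [AddCommGroup F₃] [Module R F₃] [Module A F₃] [IsScalarTower A R F₃]
    [Module.Free R F₁] [Module.Finite R F₁]
    [Module.Free R F₂] [Module.Finite R F₂]
    [Module.Free R F₃] [Module.Finite R F₃]
    (a : F₁ →ₗ[R] F₂) (b : F₂ →ₗ[R] F₃)
    (hba : b ∘ₗ a = 0)
    (ha : Function.Injective a) (hb : Function.Surjective b) :
    Module.Flat A
        (↥(LinearMap.ker b) ⧸ (LinearMap.range a).comap (LinearMap.ker b).subtype) ↔
      ∀ m : Ideal A, m.IsMaximal →
        Function.Injective (LinearMap.baseChange (A ⧸ m) (LinearMap.restrictScalars A a)) := by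
  have hF₂ : Module.Flat A F₂ := Module.Flat.trans A R F₂
  obtain ⟨s, hs⟩ := b.exists_rightInverse_of_surjective (LinearMap.range_eq_top.mpr hb)
  let ι : LinearMap.ker b →ₗ[A] F₂ := (LinearMap.ker b).subtype.restrictScalars A
  let ρ : F₂ →ₗ[A] LinearMap.ker b := (LinearMap.codRestrict (LinearMap.ker b)
    (LinearMap.id - s ∘ₗ b) fun x ↦ by
      simpa [sub_eq_zero] using (LinearMap.congr_fun hs (b x)).symm).restrictScalars A
  have hρ : ρ ∘ₗ ι = LinearMap.id := by
    ext x
    simp [ρ, ι]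
  have hker : Module.Flat A (LinearMap.ker b) := Module.Flat.of_retract ι ρ hρ
  let a' : F₁ →ₗ[A] LinearMap.ker b :=
    (a.codRestrict (LinearMap.ker b) (LinearMap.congr_fun hba)).restrictScalars A
  let P := (LinearMap.range a).comap (LinearMap.ker b).subtype
  let g : LinearMap.ker b →ₗ[A] LinearMap.ker b ⧸ P := P.mkQ.restrictScalars A
  have hg : Function.Surjective g := P.mkQ_surjective
  have hag : Function.Exact a' g := by
    intro y
    change Submodule.Quotient.mk y = 0 ↔ _
    rw [Submodule.Quotient.mk_eq_zero]
    exact ⟨fun ⟨x, hx⟩ ↦ ⟨x, Subtype.ext hx⟩, fun ⟨x, hx⟩ ↦ ⟨x, congr_arg Subtype.val hx⟩⟩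
  have ha' : Function.Injective a' := fun x y h ↦ ha (congr_arg Subtype.val h)
  have hιN (m : Ideal A) : Function.Injective (ι.lTensor (A ⧸ m)) := by
    refine Function.LeftInverse.injective (g := ρ.lTensor (A ⧸ m)) fun x ↦ ?_
    rw [← LinearMap.comp_apply, ← LinearMap.lTensor_comp, hρ, LinearMap.lTensor_id,
      LinearMap.id_apply]
  have hiff (m : Ideal A) : Function.Injective ((a.restrictScalars A).baseChange (A ⧸ m)) ↔
      Function.Injective (a'.lTensor (A ⧸ m)) := by
    change Function.Injective ((ι ∘ₗ a').lTensor (A ⧸ m)) ↔ _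
    rw [LinearMap.lTensor_comp, LinearMap.coe_comp, (hιN m).of_comp_iff]
  simp only [hiff]
  constructor
  · intro _ m _
    exact LinearMap.lTensor_injective_of_flat_of_exact ha' hag hg _
  · intro h
    have : IsNoetherianRing R := Algebra.FiniteType.isNoetherianRing k R
    exact Module.Flat.of_exact_of_lTensor_quotient_injective hag hg
      (LinearMap.lTensor_quotient_injective_of_forall_isMaximal (R := R)
        (fun q _ ↦ q.isMaximal_comap_algebraMap_of_finiteType k) h)
end

section
/- Let R be a regular local ring of Krull dimension at most 2 and let M be a finitely generated R-module. Then the dual module Hom_R(M, R) is a finite free R-module. -/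
open IsLocalRing Pointwise

/-- In a noetherian local ring, a principal prime ideal that is not a minimal prime forces the
ring to be a domain. -/
lemma IsLocalRing.isDomain_of_isPrime_span_singleton {R : Type*} [CommRing R] [IsNoetherianRing R]
    [IsLocalRing R] {z : R} (hz : (Ideal.span {z}).IsPrime)
    (hmin : Ideal.span {z} ∉ minimalPrimes R) : IsDomain R := by
  obtain ⟨q, hq, hle⟩ := Ideal.exists_minimalPrimes_le (I := ⊥) (J := Ideal.span {z}) bot_le
  have hqp : q.IsPrime := hq.1.1
  have hzq : z ∉ q := fun h ↦ hmin <| by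
    rwa [← le_antisymm hle ((Ideal.span_singleton_le_iff_mem q).mpr h)]
  have hbot : q = ⊥ := by
    refine Submodule.eq_bot_of_le_smul_of_le_jacobson_bot (Ideal.span {z}) q
      (IsNoetherian.noetherian q) (fun a ha ↦ ?_)
      ((le_maximalIdeal hz.ne_top).trans (maximalIdeal_le_jacobson _))
    obtain ⟨b, rfl⟩ := Ideal.mem_span_singleton'.mp (hle ha)
    rw [mul_comm]
    exact Submodule.smul_mem_smul (Ideal.mem_span_singleton_self z)
      ((hqp.mem_or_mem ha).resolve_right hzq)
  have : (⊥ : Ideal R).IsPrime := hbot ▸ hqp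
  exact IsDomain.of_bot_isPrime R

lemma IsLocalRing.ringKrullDim_le_card_of_span_eq {R : Type*} [CommRing R] [IsNoetherianRing R]
    [IsLocalRing R] {s : Finset R} (hs : Ideal.span (s : Set R) = maximalIdeal R) :
    ringKrullDim R ≤ s.card := by
  refine (ringKrullDim_le_spanFinrank_maximalIdeal R).trans ?_
  rw [← hs, ← Set.ncard_coe_finset s]
  exact_mod_cast Submodule.spanFinrank_span_le_ncard_of_finite s.finite_toSet

lemma IsLocalRing.ringKrullDim_le_one_of_span_singleton_eq {R : Type*} [CommRing R]
    [IsNoetherianRing R] [IsLocalRing R] {x : R} (hx : Ideal.span {x} = maximalIdeal R) :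
    ringKrullDim R ≤ 1 := by
  simpa using ringKrullDim_le_card_of_span_eq (s := {x}) (by simpa using hx)

lemma IsLocalRing.isDomain_of_span_singleton_eq {R : Type*} [CommRing R] [IsNoetherianRing R]
    [IsLocalRing R] {x : R} (hx : Ideal.span {x} = maximalIdeal R) (hdim : 1 ≤ ringKrullDim R) :
    IsDomain R := by
  refine isDomain_of_isPrime_span_singleton (z := x) (by rw [hx]; infer_instance) fun hmin ↦ ?_
  rw [hx] at hmin
  have h0 := Ideal.height_eq_zero_iff.mpr hmin
  rw [← maximalIdeal_height_eq_ringKrullDim, h0] at hdim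
  exact absurd hdim (by decide)

lemma IsLocalRing.span_singleton_mk_eq_maximalIdeal {R : Type*} [CommRing R] [IsLocalRing R]
    {x y : R} (h : Ideal.span {x, y} = maximalIdeal R) [IsLocalRing (R ⧸ Ideal.span {x})] :
    Ideal.span {Ideal.Quotient.mk (Ideal.span {x}) y} = maximalIdeal (R ⧸ Ideal.span {x}) := by
  rw [← map_maximalIdeal_of_surjective _ (Ideal.Quotient.mk_surjective (I := Ideal.span {x})),
    ← h, Ideal.map_span, Set.image_pair,
    Ideal.Quotient.eq_zero_iff_mem.mpr (Ideal.mem_span_singleton_self x), Ideal.span_insert_zero]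

lemma IsLocalRing.isPrime_span_singleton_of_span_pair_eq {R : Type*} [CommRing R]
    [IsNoetherianRing R] [IsLocalRing R] {x y : R} (h : Ideal.span {x, y} = maximalIdeal R)
    (hdim : 2 ≤ ringKrullDim R) : (Ideal.span {x}).IsPrime := by
  have hx : x ∈ maximalIdeal R := h ▸ Ideal.subset_span (by simp)
  have hne : Ideal.span {x} ≠ ⊤ := ne_top_of_le_ne_top (maximalIdeal.isMaximal R).ne_top
    ((Ideal.span_singleton_le_iff_mem _).mpr hx)
  have : Nontrivial (R ⧸ Ideal.span {x}) := Ideal.Quotient.nontrivial_iff.mpr hne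
  have : IsLocalRing (R ⧸ Ideal.span {x}) :=
    .of_surjective' (Ideal.Quotient.mk _) Ideal.Quotient.mk_surjective
  have hle : ringKrullDim R ≤ ringKrullDim (R ⧸ Ideal.span {x}) + 1 := by
    have := ringKrullDim_le_ringKrullDim_quotSMulTop_succ hx
    rwa [← Submodule.ideal_span_singleton_smul, smul_eq_mul, Ideal.mul_top] at this
  have h1 : 1 ≤ ringKrullDim (R ⧸ Ideal.span {x}) := by
    by_contra! hlt
    have h0 : ringKrullDim (R ⧸ Ideal.span {x}) ≤ 0 := 
      ENat.WithBot.lt_add_one_iff (m := 0).mp (by simpa using hlt)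
    have := (hdim.trans hle).trans (add_le_add_left h0 1)
    exact absurd this (by decide)
  exact (Ideal.Quotient.isDomain_iff_prime _).mp
    (isDomain_of_span_singleton_eq (span_singleton_mk_eq_maximalIdeal h) h1)

lemma IsLocalRing.isDomain_of_span_pair_eq {R : Type*} [CommRing R] [IsNoetherianRing R]
    [IsLocalRing R] {x y : R} (h : Ideal.span {x, y} = maximalIdeal R)
    (hdim : 2 ≤ ringKrullDim R) : IsDomain R := by
  have hy : y ∈ maximalIdeal R := h ▸ Ideal.subset_span (by simp)
  have hgen (n : ℕ) : Ideal.span {x + y ^ (n + 1), y} = maximalIdeal R := by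
    rw [← h, pow_succ, Ideal.span_pair_add_mul_right]
  have hprime (n : ℕ) : (Ideal.span {x + y ^ (n + 1)}).IsPrime :=
    isPrime_span_singleton_of_span_pair_eq (hgen n) hdim
  have hinj : Function.Injective fun n : ℕ ↦ Ideal.span {x + y ^ (n + 1)} := by
    refine Function.Injective.of_lt_imp_ne fun a b hab heq ↦ ?_
    have hya : y ^ (a + 1) ∈ Ideal.span {x + y ^ (a + 1)} := by
      have hu : IsUnit (1 - y ^ (b - a)) := by
        by_contra hn
        have := Ideal.add_mem _ ((mem_maximalIdeal _).mpr hn)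
          (Ideal.pow_mem_of_mem _ hy (b - a) (by omega))
        simp at this
      rw [← Ideal.mul_unit_mem_iff_mem _ hu]
      have hb : x + y ^ (b + 1) ∈ Ideal.span {x + y ^ (a + 1)} :=
        heq ▸ Ideal.mem_span_singleton_self _
      have := Ideal.sub_mem _ (Ideal.mem_span_singleton_self (x + y ^ (a + 1))) hb
      convert this using 1
      rw [mul_sub, ← pow_add, show a + 1 + (b - a) = b + 1 by omega]
      ring
    have hy' := (hprime a).mem_of_pow_mem _ hya
    have hm : Ideal.span {x + y ^ (a + 1)} = maximalIdeal R := by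
      rw [← hgen a, Ideal.span_insert, left_eq_sup]
      exact (Ideal.span_singleton_le_iff_mem _).mpr hy'
    exact absurd (hdim.trans (ringKrullDim_le_one_of_span_singleton_eq hm)) (by decide)
  obtain ⟨_, ⟨n, rfl⟩, hn⟩ := (Set.infinite_range_of_injective hinj).exists_notMem_finite
    (minimalPrimes.finite_of_isNoetherianRing R)
  exact isDomain_of_isPrime_span_singleton (hprime n) hn

lemma IsLocalRing.free_of_isSMulRegular_of_span_singleton_eq {R : Type*} [CommRing R]
    [IsNoetherianRing R] [IsLocalRing R] {x : R} (hx : Ideal.span {x} = maximalIdeal R)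
    {N : Type*} [AddCommGroup N] [Module R N] [Module.Finite R N] (hreg : IsSMulRegular N x) :
    Module.Free R N := by
  have hm : (Ideal.span {x}).IsMaximal := hx ▸ inferInstance
  have := Module.finitePresentation_of_finite R N
  refine (Module.free_quotSMulTop_iff_free R N (maximalIdeal_le_jacobson _
    (hx ▸ Ideal.mem_span_singleton_self x)) hreg).mp ?_
  let := Ideal.Quotient.field (Ideal.span {x})
  exact Module.Free.of_divisionRing (R ⧸ Ideal.span {x}) (QuotSMulTop x N)

lemma IsLocalRing.free_of_isSMulRegular_of_span_pair_eq {R : Type*} [CommRing R]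
    [IsNoetherianRing R] [IsLocalRing R] {x y : R} (h : Ideal.span {x, y} = maximalIdeal R)
    {N : Type*} [AddCommGroup N] [Module R N] [Module.Finite R N] (hx : IsSMulRegular N x)
    (hy : IsSMulRegular (QuotSMulTop x N) y) : Module.Free R N := by
  have hxm : x ∈ maximalIdeal R := h ▸ Ideal.subset_span (by simp)
  have hne : Ideal.span {x} ≠ ⊤ := ne_top_of_le_ne_top (maximalIdeal.isMaximal R).ne_top
    ((Ideal.span_singleton_le_iff_mem _).mpr hxm)
  have : Nontrivial (R ⧸ Ideal.span {x}) := Ideal.Quotient.nontrivial_iff.mpr hne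
  have : IsLocalRing (R ⧸ Ideal.span {x}) :=
    .of_surjective' (Ideal.Quotient.mk _) Ideal.Quotient.mk_surjective
  have := Module.Finite.of_restrictScalars_finite R (R ⧸ Ideal.span {x}) (QuotSMulTop x N)
  have := Module.finitePresentation_of_finite R N
  refine (Module.free_quotSMulTop_iff_free R N (maximalIdeal_le_jacobson _ hxm) hx).mp ?_
  refine free_of_isSMulRegular_of_span_singleton_eq (span_singleton_mk_eq_maximalIdeal h) ?_
  intro a b hab
  refine hy ?_
  simpa [← Ideal.Quotient.algebraMap_eq, algebraMap_smul] using hab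

lemma LinearMap.isSMulRegular_of_isSMulRegular_codomain {R M N : Type*} [CommRing R]
    [AddCommGroup M] [Module R M] [AddCommGroup N] [Module R N] {x : R} (hx : IsSMulRegular N x) :
    IsSMulRegular (M →ₗ[R] N) x :=
  fun _ _ h ↦ LinearMap.ext fun m ↦ hx (LinearMap.congr_fun h m)

lemma LinearMap.mem_smul_top_of_forall_mem {R M N : Type*} [CommRing R] [AddCommGroup M]
    [Module R M] [AddCommGroup N] [Module R N] {x : R} (hx : IsSMulRegular N x) {f : M →ₗ[R] N}
    (hf : ∀ m, f m ∈ x • (⊤ : Submodule R N)) : f ∈ x • (⊤ : Submodule R (M →ₗ[R] N)) := by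
  have hf' (m : M) : ∃ n, x • n = f m := by
    simpa [Submodule.mem_smul_pointwise_iff_exists] using hf m
  choose g hg using hf'
  refine (Submodule.mem_smul_pointwise_iff_exists _ _ _).mpr ⟨
    { toFun := g
      map_add' := fun a b ↦ hx (by simp [hg])
      map_smul' := fun c a ↦ hx (by simp [hg, smul_comm x c]) }, trivial, ?_⟩
  ext m
  exact hg m

lemma LinearMap.isSMulRegular_quotSMulTop {R M N : Type*} [CommRing R] [AddCommGroup M]
    [Module R M] [AddCommGroup N] [Module R N] {x y : R} (hx : IsSMulRegular N x)
    (hy : IsSMulRegular (QuotSMulTop x N) y) : IsSMulRegular (QuotSMulTop x (M →ₗ[R] N)) y := by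
  refine (isSMulRegular_quotient_iff_mem_of_smul_mem _ _).mpr fun f hf ↦ ?_
  obtain ⟨g, -, hg⟩ := (Submodule.mem_smul_pointwise_iff_exists _ _ _).mp hf
  refine mem_smul_top_of_forall_mem hx fun m ↦ mem_of_isSMulRegular_quotient_of_smul_mem hy ?_
  rw [← LinearMap.smul_apply, ← hg]
  exact Submodule.smul_mem_pointwise_smul _ _ _ trivial

/-- Let `R` be a regular local ring (a noetherian local ring whose maximal ideal is
generated by `dim R` elements) of Krull dimension at most 2, and let `M` be a finitely
generated `R`-module. Then the dual module `Hom_R(M, R)` is a finite free `R`-module. -/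
theorem statement8
    (R : Type*) [CommRing R] [IsNoetherianRing R] [IsLocalRing R]
    (hreg : ∃ s : Finset R,
      Ideal.span (s : Set R) = IsLocalRing.maximalIdeal R ∧
      (s.card : WithBot (WithTop ℕ)) = ringKrullDim R)
    (hdim : ringKrullDim R ≤ 2)
    (M : Type*) [AddCommGroup M] [Module R M] [Module.Finite R M] :
    Module.Free R (M →ₗ[R] R) ∧ Module.Finite R (M →ₗ[R] R) := by
  refine ⟨?_, inferInstance⟩
  obtain ⟨s, hs, hcard⟩ := hreg
  have hle : s.card ≤ 2 := by
    have h : (s.card : WithBot ℕ∞) ≤ (2 : ℕ) := hcard.trans_le hdim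
    exact_mod_cast h
  interval_cases hn : s.card
  · rw [Finset.card_eq_zero.mp hn, Finset.coe_empty, Ideal.span_empty] at hs
    let := (isField_iff_maximalIdeal_eq.mpr hs.symm).toField
    exact Module.Free.of_divisionRing R (M →ₗ[R] R)
  · obtain ⟨x, rfl⟩ := Finset.card_eq_one.mp hn
    rw [Finset.coe_singleton] at hs
    have hdom := isDomain_of_span_singleton_eq hs hcard.le
    have hx : x ≠ 0 := by
      rintro rfl
      have h0 := ringKrullDim_le_card_of_span_eq (R := R) (s := ∅) (by simpa using hs)
      rw [← hcard] at h0
      exact absurd h0 (show ¬ (1 : WithBot ℕ∞) ≤ 0 by decide)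
    exact free_of_isSMulRegular_of_span_singleton_eq hs
      (LinearMap.isSMulRegular_of_isSMulRegular_codomain (IsSMulRegular.of_ne_zero hx))
  · let := Classical.decEq R
    obtain ⟨x, y, -, rfl⟩ := Finset.card_eq_two.mp hn
    rw [Finset.coe_pair] at hs
    have hdom := isDomain_of_span_pair_eq hs hcard.le
    have hprime := isPrime_span_singleton_of_span_pair_eq hs hcard.le
    have hnot {z : R} (hz : Ideal.span {z} = maximalIdeal R) : False :=
      absurd (hcard.le.trans (ringKrullDim_le_one_of_span_singleton_eq hz))
        (show ¬ (2 : WithBot ℕ∞) ≤ 1 by decide)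
    have hx : IsSMulRegular R x := IsSMulRegular.of_ne_zero <| by
      rintro rfl
      exact hnot (by rwa [Ideal.span_insert_zero] at hs)
    have hyx : y ∉ Ideal.span {x} := fun hy ↦ hnot (z := x) <| by
      rw [← hs, Ideal.span_insert, left_eq_sup]
      exact (Ideal.span_singleton_le_iff_mem _).mpr hy
    have hy : IsSMulRegular (QuotSMulTop x R) y := by
      refine (isSMulRegular_quotient_iff_mem_of_smul_mem _ _).mpr fun r hr ↦ ?_
      rw [← Submodule.ideal_span_singleton_smul, smul_eq_mul, Ideal.mul_top] at hr ⊢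
      exact (hprime.mem_or_mem hr).resolve_left hyx
    exact free_of_isSMulRegular_of_span_pair_eq hs
      (LinearMap.isSMulRegular_of_isSMulRegular_codomain hx)
      (LinearMap.isSMulRegular_quotSMulTop hx hy)
end
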